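/- (Lemma A2) Let U be a p × p real orthogonal matrix (U U^T = I_p), let b ∈ ℝ^p, and let r ∈ ℕ with r ≥ 2. Then ∑_{i=1}^p ∑_{k=1}^p ∑_{l=1}^p u_{ik}^r u_{il}^r b_k b_l ≤ ∑_{k=1}^p b_k^2. -/

import Mathlib

open Matrix

/-- Lemma A2: Let `U` be a `p × p` real orthogonal matrix, `b ∈ ℝ^p`, and
`r ∈ ℕ` with `r ≥ 2`. Then `∑_i ∑_k ∑_l u_{ik}^r u_{il}^r b_k b_l ≤ ∑_k b_k^2`. -/
theorem orthogonal_power_sum_inequality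
    (p : ℕ) (U : Matrix (Fin p) (Fin p) ℝ) (hU : U * Uᵀ = 1)
    (b : Fin p → ℝ) (r : ℕ) (hr : 2 ≤ r) :
    ∑ i, ∑ k, ∑ l, (U i k) ^ r * (U i l) ^ r * b k * b l ≤ ∑ k, (b k) ^ 2 := by
  have hU' : Uᵀ * U = 1 := mul_eq_one_comm.mp hU
  have hrow : ∀ i, ∑ k, (U i k) ^ 2 = 1 := by
    intro i
    have h := congrFun (congrFun hU i) i
    simpa [Matrix.mul_apply, sq] using h
  have hcol : ∀ k, ∑ i, (U i k) ^ 2 = 1 := by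
    intro k
    have h := congrFun (congrFun hU' k) k
    simpa [Matrix.mul_apply, sq] using h
  have hle : ∀ i k, (U i k) ^ 2 ≤ 1 := by
    intro i k
    rw [← hrow i]
    exact Finset.single_le_sum (f := fun k => (U i k) ^ 2)
      (fun _ _ => sq_nonneg _) (Finset.mem_univ k)
  obtain ⟨s, rfl⟩ := Nat.exists_eq_add_of_le hr
  have key : ∀ i, ∑ k, ∑ l, (U i k) ^ (2 + s) * (U i l) ^ (2 + s) * b k * b l
      ≤ ∑ k, (U i k) ^ 2 * (b k) ^ 2 := by
    intro i
    have h1 : ∑ k, ∑ l, (U i k) ^ (2 + s) * (U i l) ^ (2 + s) * b k * b l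
        = (∑ k, U i k * ((U i k) ^ (1 + s) * b k)) ^ 2 := by
      rw [sq, Finset.sum_mul_sum]
      refine Finset.sum_congr rfl fun k _ => Finset.sum_congr rfl fun l _ => ?_
      ring
    have h2 := Finset.sum_mul_sq_le_sq_mul_sq Finset.univ (fun k => U i k)
      (fun k => (U i k) ^ (1 + s) * b k)
    rw [hrow i, one_mul] at h2
    rw [h1]
    refine h2.trans (Finset.sum_le_sum fun k _ => ?_)
    have h3 : ((U i k) ^ 2) ^ s ≤ 1 := pow_le_one₀ (sq_nonneg _) (hle i k)
    calc ((U i k) ^ (1 + s) * b k) ^ 2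
        = ((U i k) ^ 2) ^ s * ((U i k) ^ 2 * (b k) ^ 2) := by ring
      _ ≤ 1 * ((U i k) ^ 2 * (b k) ^ 2) :=
          mul_le_mul_of_nonneg_right h3 (by positivity)
      _ = _ := one_mul _
  refine (Finset.sum_le_sum fun i _ => key i).trans (le_of_eq ?_)
  rw [Finset.sum_comm]
  refine Finset.sum_congr rfl fun k _ => ?_
  rw [← Finset.sum_mul, hcol k, one_mul]
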